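/- Let T be a Toeplitz operator on 𝐄 and for n ∈ ℕ set φ_n = Σ_{k=−n}^{n} (1 − |k|/(n+1)) T̂(k) e_k (a finitely supported sequence on ℤ). Then for every x ∈ 𝐄, P⁺(φ_n ∗ x) belongs to 𝐄 with ‖P⁺(φ_n ∗ x)‖ ≤ ‖T‖·‖x‖, and lim_{n→∞} ‖P⁺(φ_n ∗ x) − Tx‖ = 0. -/

import Mathlib

open Filter

namespace Fejer

/-- The exponential `exp (i l θ)`. -/
noncomputable def ex (l : ℤ) (t : ℝ) : ℂ := Complex.exp ((l : ℂ) * Complex.I * t)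

lemma ex_add (k l : ℤ) (t : ℝ) : ex (k + l) t = ex k t * ex l t := by
  simp only [ex, ← Complex.exp_add]; congr 1; push_cast; ring

lemma ex_neg_arg (k : ℤ) (t : ℝ) : ex k (-t) = ex (-k) t := by
  simp only [ex]; congr 1; push_cast; ring

lemma ex_pow (m : ℕ) (t : ℝ) : ex 1 t ^ m = ex m t := by
  simp only [ex, ← Complex.exp_nat_mul]; congr 1; push_cast; ring

lemma conj_ex (k : ℤ) (t : ℝ) : (starRingEnd ℂ) (ex k t) = ex (-k) t := by
  simp only [ex, ← Complex.exp_conj]; congr 1; simp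

lemma norm_ex (k : ℤ) (t : ℝ) : ‖ex k t‖ = 1 := by
  have : (k : ℂ) * Complex.I * t = ((k * t : ℝ) : ℂ) * Complex.I := by push_cast; ring
  rw [ex, this, Complex.norm_exp_ofReal_mul_I]

lemma continuous_ex (k : ℤ) : Continuous (ex k) := by
  unfold ex; fun_prop

lemma integral_ex (l : ℤ) :
    ∫ t in (0 : ℝ)..(2 * Real.pi), ex l t = if l = 0 then (2 * Real.pi : ℂ) else 0 := by
  split_ifs with h
  · subst h; simp [ex]
  · unfold ex
    have hc : (l : ℂ) * Complex.I ≠ 0 := by simp [h]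
    rw [integral_exp_mul_complex hc]
    have : (l : ℂ) * Complex.I * ((2 * Real.pi : ℝ) : ℂ) = l * (2 * Real.pi * Complex.I) := by
      push_cast; ring
    rw [this, Complex.exp_int_mul_two_pi_mul_I]
    simp

/-- Fejer kernel. -/
noncomputable def K (n : ℕ) (t : ℝ) : ℝ :=
  ((n : ℝ) + 1)⁻¹ * ‖∑ a ∈ Finset.Icc (0 : ℤ) n, ex a t‖ ^ 2

lemma K_nonneg (n : ℕ) (t : ℝ) : 0 ≤ K n t := by unfold K; positivity

lemma continuous_K (n : ℕ) : Continuous (K n) := by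
  unfold K
  have := continuous_ex
  fun_prop

/-- Fejer coefficients. -/
noncomputable def cf (n : ℕ) (l : ℤ) : ℝ := if |l| ≤ n then 1 - ((|l| : ℤ) : ℝ) / ((n : ℝ) + 1) else 0

lemma K_eq (n : ℕ) (t : ℝ) : (K n t : ℂ) =
    ((n : ℂ) + 1)⁻¹ * ∑ a ∈ Finset.Icc (0 : ℤ) n, ∑ b ∈ Finset.Icc (0 : ℤ) n, ex (a - b) t := by
  unfold K
  push_cast
  rw [← Complex.mul_conj', map_sum, Finset.sum_mul_sum]
  simp_rw [conj_ex, ← ex_add, sub_eq_add_neg]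

lemma integral_K (n : ℕ) (l : ℤ) :
    ((2 * Real.pi : ℝ)⁻¹ : ℝ) • ∫ t in (0 : ℝ)..(2 * Real.pi), (K n t : ℂ) * ex l t = (cf n l : ℂ) := by
  have hI : ∀ k : ℤ, IntervalIntegrable (ex k) MeasureTheory.volume 0 (2 * Real.pi) :=
    fun k => (continuous_ex k).intervalIntegrable _ _
  have h1 : ∀ t, (K n t : ℂ) * ex l t = ((n : ℂ) + 1)⁻¹ *
      ∑ a ∈ Finset.Icc (0 : ℤ) n, ∑ b ∈ Finset.Icc (0 : ℤ) n, ex (a - b + l) t := by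
    intro t
    rw [K_eq, mul_assoc, Finset.sum_mul]
    simp_rw [Finset.sum_mul, ← ex_add]
  simp_rw [h1]
  rw [intervalIntegral.integral_const_mul, intervalIntegral.integral_finsetSum]
  swap
  · intro a _
    exact (continuous_finsetSum _ fun b _ => continuous_ex _).intervalIntegrable _ _
  simp_rw [intervalIntegral.integral_finsetSum (fun b _ => hI _), integral_ex]
  have h2 : ∀ a ∈ Finset.Icc (0 : ℤ) n, (∑ b ∈ Finset.Icc (0 : ℤ) n,
      if a - b + l = 0 then (2 * Real.pi : ℂ) else 0) =
      if a ∈ Finset.Icc (-l) (n - l) then (2 * Real.pi : ℂ) else 0 := by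
    intro a _
    have : ∀ b : ℤ, (a - b + l = 0) ↔ a + l = b := fun b => by constructor <;> intro h <;> omega
    simp_rw [this]
    rw [Finset.sum_ite_eq]
    congr 1
    simp only [Finset.mem_Icc, eq_iff_iff]
    omega
  rw [Finset.sum_congr rfl h2, ← Finset.sum_filter, Finset.filter_mem_eq_inter, Finset.sum_const]
  have h3 : (Finset.Icc (0 : ℤ) n ∩ Finset.Icc (-l) (n - l)).card = (n + 1 - |l|).toNat := by
    have h4 : Finset.Icc (0 : ℤ) n ∩ Finset.Icc (-l) (n - l) =
        Finset.Icc (max 0 (-l)) (min (n : ℤ) (n - l)) := by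
      ext a
      simp only [Finset.mem_inter, Finset.mem_Icc, max_le_iff, le_min_iff]
      tauto
    rw [h4, Int.card_Icc]
    congr 1
    rcases abs_cases l with h | h <;> simp only [max_def, min_def] <;> split_ifs <;> omega
  rw [h3]
  have hp : (Real.pi : ℂ) ≠ 0 := by exact_mod_cast Real.pi_ne_zero
  have hn : (n : ℂ) + 1 ≠ 0 := by exact_mod_cast Nat.succ_ne_zero n
  unfold cf
  split_ifs with h
  · have : (((n + 1 - |l|).toNat : ℕ) : ℂ) = n + 1 - ((|l| : ℤ) : ℂ) := by
      have : (((n + 1 - |l|).toNat : ℕ) : ℤ) = n + 1 - |l| := Int.toNat_of_nonneg (by omega)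
      exact_mod_cast congrArg (Int.cast : ℤ → ℂ) this
    rw [nsmul_eq_mul, this, Complex.real_smul]
    rw [Complex.ofReal_sub, Complex.ofReal_div, Complex.ofReal_intCast, Complex.ofReal_inv]
    push_cast
    field_simp
  · have : (n + 1 - |l|).toNat = 0 := by omega
    rw [this]; simp

lemma integral_K_real (n : ℕ) :
    (2 * Real.pi)⁻¹ * ∫ t in (0 : ℝ)..(2 * Real.pi), K n t = 1 := by
  have h := integral_K n 0
  have h1 : ∀ t, (K n t : ℂ) * ex 0 t = ((K n t : ℝ) : ℂ) := by intro t; simp [ex]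
  simp_rw [h1] at h
  rw [intervalIntegral.integral_ofReal, Complex.real_smul] at h
  have h2 : cf n 0 = 1 := by simp [cf]
  rw [h2] at h
  exact_mod_cast h

lemma tendsto_cf (l : ℤ) : Tendsto (fun n => cf n l) atTop (nhds 1) := by
  have h : Tendsto (fun n : ℕ => 1 - ((|l| : ℤ) : ℝ) / ((n : ℝ) + 1)) atTop (nhds (1 - 0)) := by
    refine tendsto_const_nhds.sub ?_
    have := (tendsto_one_div_add_atTop_nhds_zero_nat (𝕜 := ℝ)).const_mul ((|l| : ℤ) : ℝ)
    simpa [div_eq_mul_inv] using this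
  rw [sub_zero] at h
  refine h.congr' ?_
  filter_upwards [eventually_ge_atTop (|l|).toNat] with n hn
  rw [cf, if_pos (by omega)]

section
variable {E : Type*} [NormedAddCommGroup E] [NormedSpace ℂ E] [CompleteSpace E]

/-- Averaging a strongly continuous family against the Fejer kernel. -/
lemma exists_av (G : ℝ → E →L[ℂ] E) (C : ℝ) (hC : ∀ t x, ‖G t x‖ ≤ C * ‖x‖)
    (hG : ∀ x, Continuous fun t => G t x) (n : ℕ) :
    ∃ A : E →L[ℂ] E, (∀ x, ‖A x‖ ≤ C * ‖x‖) ∧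
      ∀ x, A x = (2 * Real.pi : ℝ)⁻¹ • ∫ t in (0 : ℝ)..(2 * Real.pi), (K n t : ℂ) • G t x := by
  have hK : Continuous fun t => (K n t : ℂ) := Complex.continuous_ofReal.comp (continuous_K n)
  have hI : ∀ x, IntervalIntegrable (fun t => (K n t : ℂ) • G t x) MeasureTheory.volume
      0 (2 * Real.pi) := fun x => (hK.smul (hG x)).intervalIntegrable _ _
  have hb : ∀ x, ‖(2 * Real.pi : ℝ)⁻¹ • ∫ t in (0 : ℝ)..(2 * Real.pi), (K n t : ℂ) • G t x‖
      ≤ C * ‖x‖ := by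
    intro x
    rw [norm_smul, norm_inv, Real.norm_of_nonneg Real.two_pi_pos.le]
    have h1 : ‖∫ t in (0 : ℝ)..(2 * Real.pi), (K n t : ℂ) • G t x‖ ≤
        ∫ t in (0 : ℝ)..(2 * Real.pi), K n t * (C * ‖x‖) := by
      refine intervalIntegral.norm_integral_le_of_norm_le Real.two_pi_pos.le ?_
        (((continuous_K n).mul continuous_const).intervalIntegrable _ _)
      refine Eventually.of_forall fun t _ => ?_
      rw [norm_smul, Complex.norm_real, Real.norm_of_nonneg (K_nonneg n t)]
      exact mul_le_mul_of_nonneg_left (hC t x) (K_nonneg n t)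
    rw [intervalIntegral.integral_mul_const] at h1
    calc _ ≤ (2 * Real.pi)⁻¹ * ((∫ t in (0 : ℝ)..(2 * Real.pi), K n t) * (C * ‖x‖)) :=
          mul_le_mul_of_nonneg_left h1 (by positivity)
      _ = C * ‖x‖ := by rw [← mul_assoc, integral_K_real, one_mul]
  let L : E →ₗ[ℂ] E :=
    { toFun := fun x => (2 * Real.pi : ℝ)⁻¹ • ∫ t in (0 : ℝ)..(2 * Real.pi), (K n t : ℂ) • G t x
      map_add' := by
        intro x y
        simp only [map_add, smul_add]
        rw [intervalIntegral.integral_add (hI x) (hI y), smul_add]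
      map_smul' := by
        intro c x
        simp only [map_smul, RingHom.id_apply]
        simp_rw [smul_comm _ c (G _ x)]
        rw [intervalIntegral.integral_smul, smul_comm] }
  exact ⟨L.mkContinuous C hb, hb, fun x => rfl⟩

lemma tendsto_of_span (A : ℕ → E →L[ℂ] E) (B : E →L[ℂ] E) (C : NNReal)
    (hA : ∀ n x, ‖A n x‖ ≤ C * ‖x‖) (e : ℕ → E)
    (hdense : Dense (Submodule.span ℂ (Set.range e) : Set E))
    (h : ∀ k, Tendsto (fun n => A n (e k)) atTop (nhds (B (e k)))) (x : E) :
    Tendsto (fun n => A n x) atTop (nhds (B x)) := by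
  have hl : ∀ n, LipschitzWith C (A n) := fun n =>
    AddMonoidHomClass.lipschitz_of_bound_nnnorm (A n) C (fun x => hA n x)
  have he : Equicontinuous (fun n => (A n : E → E)) :=
    (LipschitzWith.uniformEquicontinuous _ C hl).equicontinuous
  refine (he x).tendsto_of_mem_closure (B.continuous.continuousAt.mono_left inf_le_left) ?_ (hdense x)
  intro y hy
  induction hy using Submodule.span_induction with
  | mem y hy => obtain ⟨k, rfl⟩ := hy; exact h k
  | zero => simp
  | add y z _ _ h1 h2 => simpa using h1.add h2
  | smul c y _ h1 => simpa using h1.const_smul c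

end

end Fejer

open Fejer in
/-- For a Toeplitz operator `T` on `𝐄` and
`φ_n = Σ_{k=−n}^{n} (1 − |k|/(n+1)) T̂(k) e_k`, the sequence `P⁺(φ_n ∗ x)` belongs to
`𝐄` (here `y n` is the element of `𝐄` whose coordinate sequence is `P⁺(φ_n ∗ x)`),
with `‖P⁺(φ_n ∗ x)‖ ≤ ‖T‖·‖x‖` and `P⁺(φ_n ∗ x) → Tx` in `𝐄`. -/
theorem stmt15
    {E : Type*} [NormedAddCommGroup E] [NormedSpace ℂ E] [CompleteSpace E]
    (ι : E →ₗ[ℂ] (ℕ → ℂ)) (hι : Function.Injective ι)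
    (e : ℕ → E) (he : ∀ k : ℕ, ι (e k) = Pi.single k 1)
    (hdense : Dense (Submodule.span ℂ (Set.range e) : Set E))
    (hcoord : ∀ n : ℕ, Continuous fun x : E => ι x n)
    -- (ℋ3), strengthened so that each `γ_z` is an isometry of `𝐄`:
    (Γ : ℂ → E → E)
    (hΓ : ∀ z : ℂ, ‖z‖ = 1 → ∀ x : E, ∀ n : ℕ, ι (Γ z x) n = z ^ n * ι x n)
    (hΓiso : ∀ z : ℂ, ‖z‖ = 1 → ∀ x : E, ‖Γ z x‖ = ‖x‖)
    -- `T` is a Toeplitz operator on `𝐄`: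
    (T : E →L[ℂ] E)
    (hT : ∀ k n : ℕ, ι (T (e (k + 1))) (n + 1) = ι (T (e k)) n)
    -- `Th` is the symbol sequence `T̂`:
    (Th : ℤ → ℂ)
    (hTh₁ : ∀ n : ℕ, Th n = ι (T (e 0)) n)
    (hTh₂ : ∀ n : ℕ, Th (-(n : ℤ)) = ι (T (e n)) 0) :
    ∀ x : E, ∃ y : ℕ → E,
      (∀ n : ℕ, ∀ m : ℕ, ι (y n) m =
        ∑ j ∈ Finset.Icc (-(n : ℤ)) (n : ℤ),
          (((((1 : ℝ) - ((|j| : ℤ) : ℝ) / ((n : ℝ) + 1)) : ℝ) : ℂ) * Th j)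
            * (if 0 ≤ (m : ℤ) - j then ι x ((m : ℤ) - j).toNat else 0)) ∧
      (∀ n : ℕ, ‖y n‖ ≤ ‖T‖ * ‖x‖) ∧
      Tendsto (fun n : ℕ => ‖y n - T x‖) atTop (nhds 0) := by
  -- coordinate functionals
  obtain ⟨φ, hφ⟩ : ∃ φ : ℕ → E →L[ℂ] ℂ, ∀ m x, φ m x = ι x m :=
    ⟨fun m => ⟨(LinearMap.proj m).comp ι, hcoord m⟩, fun m x => rfl⟩
  -- the isometries
  obtain ⟨U, hU⟩ : ∃ U : ℝ → E →L[ℂ] E, ∀ t x, U t x = Γ (ex 1 t) x := by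
    refine ⟨fun t => LinearMap.mkContinuous
      { toFun := Γ (ex 1 t), map_add' := ?_, map_smul' := ?_ } 1 ?_, fun t x => rfl⟩
    · intro x y
      apply hι; ext n
      simp [hΓ _ (norm_ex 1 t), mul_add]
    · intro c x
      apply hι; ext n
      simp [hΓ _ (norm_ex 1 t)]; ring
    · intro x
      simp [hΓiso _ (norm_ex 1 t)]
  have hUn : ∀ t x, ‖U t x‖ = ‖x‖ := fun t x => by rw [hU, hΓiso _ (norm_ex 1 t)]
  have hUc : ∀ t x m, φ m (U t x) = ex m t * φ m x := fun t x m => by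
    rw [hφ, hφ, hU, hΓ _ (norm_ex 1 t), ex_pow]
  have hUe : ∀ t k, U t (e k) = ex k t • e k := by
    intro t k
    apply hι; ext m
    rw [← hφ, hUc, hφ, map_smul, he]
    by_cases h : m = k
    · subst h; simp
    · simp [h]
  have hUcont : Continuous fun p : ℝ × E => U p.1 p.2 := by
    refine continuous_prod_of_dense_continuous_lipschitzWith' _ 1 hdense ?_ ?_
    · intro t
      exact AddMonoidHomClass.lipschitz_of_bound_nnnorm (U t) 1 (fun x => by
        rw [one_mul]; exact (hUn t x).le)
    · intro b hb
      simp only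
      induction hb using Submodule.span_induction with
      | mem y hy =>
        obtain ⟨k, rfl⟩ := hy
        simp_rw [hUe]
        exact (continuous_ex k).smul continuous_const
      | zero => simpa using continuous_const
      | add y z _ _ h1 h2 => simp only [map_add]; exact h1.add h2
      | smul c y _ h1 => simp only [map_smul]; exact h1.const_smul c
  -- Toeplitz matrix
  have hTm : ∀ k m : ℕ, φ m (T (e k)) = Th ((m : ℤ) - k) := by
    intro k
    induction k with
    | zero => intro m; rw [hφ, ← hTh₁]; simp
    | succ k ih =>
      intro m
      cases m with
      | zero => rw [hφ, ← hTh₂]; simp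
      | succ m => rw [hφ, hT, ← hφ, ih]; congr 1; push_cast; ring
  have hG : ∀ x, Continuous fun t => ((U t).comp (T.comp (U (-t)))) x := by
    intro x
    have h1 : Continuous fun t : ℝ => U (-t) x :=
      hUcont.comp (continuous_neg.prodMk continuous_const)
    exact hUcont.comp (continuous_id.prodMk (T.continuous.comp h1))
  have hGb : ∀ t x, ‖((U t).comp (T.comp (U (-t)))) x‖ ≤ ‖T‖ * ‖x‖ := by
    intro t x
    simp only [ContinuousLinearMap.comp_apply]
    rw [hUn]
    exact (T.le_opNorm _).trans (by rw [hUn])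
  choose Y hYb hYe using exists_av (fun t => (U t).comp (T.comp (U (-t)))) ‖T‖ hGb hG
  -- scalar integrals
  have hcoef : ∀ (H : ℝ → E) (_ : Continuous H) (n m : ℕ) (l : ℤ) (c : ℂ)
      (_ : ∀ t, φ m (H t) = ex l t * c),
      φ m ((2 * Real.pi : ℝ)⁻¹ • ∫ t in (0 : ℝ)..(2 * Real.pi), (K n t : ℂ) • H t) = cf n l * c := by
    intro H hH n m l c hc
    have hK : Continuous fun t => (K n t : ℂ) := Complex.continuous_ofReal.comp (continuous_K n)
    have hKH : Continuous fun t => (K n t : ℂ) • H t := hK.smul hH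
    rw [← Complex.coe_smul, map_smul,
      ← ContinuousLinearMap.intervalIntegral_comp_comm (φ m) (hKH.intervalIntegrable _ _)]
    simp_rw [map_smul, hc, smul_eq_mul, ← mul_assoc]
    rw [intervalIntegral.integral_mul_const, ← mul_assoc, ← integral_K n l, Complex.real_smul]
  have hYm : ∀ n k m : ℕ, φ m (Y n (e k)) = cf n ((m : ℤ) - k) * Th ((m : ℤ) - k) := by
    intro n k m
    rw [hYe]
    refine hcoef _ (hG (e k)) n m _ _ ?_
    intro t
    simp only [ContinuousLinearMap.comp_apply]
    rw [hUc, hUe, map_smul, map_smul, hTm, ex_neg_arg, smul_eq_mul, ← mul_assoc, ← ex_add,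
      sub_eq_add_neg]
  have hYt : ∀ x, Tendsto (fun n => Y n x) atTop (nhds (T x)) := by
    refine tendsto_of_span Y T ‖T‖₊ hYb e hdense ?_
    intro k
    have hB1 : ∀ x, Continuous fun t => (ex (-k) t • U t) x := fun x =>
      (continuous_ex _).smul (hUcont.comp (continuous_id.prodMk continuous_const))
    have hB2 : ∀ t x, ‖(ex (-k) t • U t) x‖ ≤ 1 * ‖x‖ := by
      intro t x
      simp [norm_smul, norm_ex, hUn]
    choose B hBb hBe using exists_av (fun t => ex (-k) t • U t) 1 hB2 hB1
    have h1 : ∀ n, Y n (e k) = B n (T (e k)) := by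
      intro n
      rw [hYe, hBe]
      congr 2
      ext t
      simp only [ContinuousLinearMap.comp_apply, ContinuousLinearMap.smul_apply]
      rw [hUe, map_smul, map_smul, ex_neg_arg]
    have h2 : ∀ n j, B n (e j) = (cf n ((j : ℤ) - k) : ℂ) • e j := by
      intro n j
      apply hι; ext m
      rw [← hφ, ← hφ, hBe, map_smul (φ m) (cf n ((j : ℤ) - k) : ℂ) (e j), smul_eq_mul]
      have : ∀ t, φ m ((ex (-k) t • U t) (e j)) = ex ((j : ℤ) - k) t * φ m (e j) := by
        intro t
        rw [ContinuousLinearMap.smul_apply, hUe, map_smul, map_smul, smul_eq_mul, smul_eq_mul,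
          ← mul_assoc, ← ex_add]
        congr 2; ring
      exact hcoef _ (hB1 (e j)) n m _ _ this
    simp_rw [h1]
    refine tendsto_of_span B (ContinuousLinearMap.id ℂ E) 1 hBb e hdense ?_ (T (e k))
    intro j
    simp_rw [h2]
    have h3 : Tendsto (fun n => (cf n ((j : ℤ) - k) : ℂ)) atTop (nhds ((1 : ℝ) : ℂ)) :=
      (Complex.continuous_ofReal.tendsto 1).comp (tendsto_cf _)
    simpa using h3.smul_const (e j)
  intro x
  refine ⟨fun n => Y n x, ?_, fun n => hYb n x, ?_⟩
  · intro n m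
    let R : E →L[ℂ] ℂ := ∑ j ∈ Finset.Icc (-(n : ℤ)) (n : ℤ),
          (((((1 : ℝ) - ((|j| : ℤ) : ℝ) / ((n : ℝ) + 1)) : ℝ) : ℂ) * Th j)
            • (if 0 ≤ (m : ℤ) - j then φ ((m : ℤ) - j).toNat else 0)
    have hR : ∀ x, R x = ∑ j ∈ Finset.Icc (-(n : ℤ)) (n : ℤ),
          (((((1 : ℝ) - ((|j| : ℤ) : ℝ) / ((n : ℝ) + 1)) : ℝ) : ℂ) * Th j)
            * (if 0 ≤ (m : ℤ) - j then ι x ((m : ℤ) - j).toNat else 0) := by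
      intro x
      simp only [R, ContinuousLinearMap.sum_apply, ContinuousLinearMap.smul_apply, smul_eq_mul]
      refine Finset.sum_congr rfl fun j _ => ?_
      split_ifs <;> simp [hφ]
    rw [← hR, ← hφ]
    have : (φ m).comp (Y n) = R := by
      refine ContinuousLinearMap.ext_on hdense ?_
      rintro _ ⟨k, rfl⟩
      rw [ContinuousLinearMap.comp_apply, hYm, hR]
      have h1 : ∀ j : ℤ, (if 0 ≤ (m : ℤ) - j then ι (e k) ((m : ℤ) - j).toNat else 0) =
          if (m : ℤ) - k = j then (1 : ℂ) else 0 := by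
        intro j
        rw [he, Pi.single_apply]
        split_ifs <;> first | rfl | omega
      simp_rw [h1, mul_ite, mul_one, mul_zero]
      rw [Finset.sum_ite_eq, cf]
      by_cases h : |(m : ℤ) - k| ≤ n
      · rw [if_pos h, if_pos (by rw [Finset.mem_Icc]; exact abs_le.mp h)]
      · rw [if_neg h, if_neg (by rw [Finset.mem_Icc]; exact fun h' => h (abs_le.mpr h'))]
        simp
    rw [← this]; rfl
  · exact tendsto_iff_norm_sub_tendsto_zero.mp (hYt x)
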